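/- arXiv:2308.14443 — 2 statements merged into one kernel-verified Lean document; each statement's English description precedes it below -/
import Mathlib

section
/- For a graph G with at least 2 vertices, μ_t(G) = 0 if and only if G has no bypass vertex, where a bypass vertex is a vertex that is not the middle vertex of any convex path on 3 vertices. -/
open SimpleGraph

/-- Two vertices are `X`-visible in `G`: some shortest path between them has
no internal vertex in `X`. -/
def IsVisiblePair {V : Type*} (G : SimpleGraph V) (X : Set V) (x y : V) : Prop :=
  ∃ p : G.Walk x y, p.IsPath ∧ p.length = G.dist x y ∧
    ∀ z ∈ p.support, z ∈ X → z = x ∨ z = y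

/-- `X` is a mutual-visibility set of `G`. -/
def MutualVisSet {V : Type*} (G : SimpleGraph V) (X : Set V) : Prop :=
  ∀ x ∈ X, ∀ y ∈ X, IsVisiblePair G X x y

/-- `X` is a total mutual-visibility set of `G`. -/
def TotalMutualVisSet {V : Type*} (G : SimpleGraph V) (X : Set V) : Prop :=
  ∀ x y : V, IsVisiblePair G X x y

/-- The mutual-visibility number `μ(G)`. -/
noncomputable def mutualVisNum {V : Type*} (G : SimpleGraph V) : ℕ :=
  sSup {n | ∃ X : Set V, MutualVisSet G X ∧ X.ncard = n}

/-- The total mutual-visibility number `μₜ(G)`. -/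
noncomputable def totalMutualVisNum {V : Type*} (G : SimpleGraph V) : ℕ :=
  sSup {n | ∃ X : Set V, TotalMutualVisSet G X ∧ X.ncard = n}

/-- A set of vertices is convex: every shortest path in `G` between two of its
vertices has all its vertices in the set. -/
def ConvexSet {V : Type*} (G : SimpleGraph V) (S : Set V) : Prop :=
  ∀ x ∈ S, ∀ y ∈ S, ∀ p : G.Walk x y, p.IsPath → p.length = G.dist x y →
    ∀ z ∈ p.support, z ∈ S

/-- `u` is the middle vertex of a convex path on three vertices `(a, u, c)`. -/
def ConvexP3Mid {V : Type*} (G : SimpleGraph V) (u : V) : Prop :=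
  ∃ a c : V, a ≠ c ∧ G.Adj a u ∧ G.Adj u c ∧ ¬ G.Adj a c ∧
    ConvexSet G {a, u, c}

/-- A bypass vertex is one that is not the middle vertex of any convex `P_3`. -/
def BypassVertex {V : Type*} (G : SimpleGraph V) (u : V) : Prop :=
  ¬ ConvexP3Mid G u

/-- If `u` is the only common neighbour of two distinct nonadjacent vertices `a` and `c`, then
`{a, u, c}` is convex. -/
theorem convexSet_of_unique_common_neighbor {V : Type*} {G : SimpleGraph V} {a u c : V}
    (hau : G.Adj a u) (huc : G.Adj u c) (hw : ∀ w, G.Adj a w → G.Adj w c → w = u) :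
    ConvexSet G {a, u, c} := by
  intro x hx y hy p _ hlen z hz
  have hdist : ∀ q : G.Walk x y, p.length ≤ q.length := fun q => hlen ▸ dist_le q
  match p, hz with
  | .nil, hz =>
    simp only [Walk.support_nil, List.mem_singleton] at hz
    exact hz ▸ hx
  | .cons h .nil, hz =>
    simp only [Walk.support_cons, Walk.support_nil, List.mem_cons, List.not_mem_nil,
      or_false] at hz
    rcases hz with rfl | rfl
    · exact hx
    · exact hy
  | .cons (v := v) h (.cons h' q), hz =>
    have hadj : ¬ G.Adj x y := fun hxy => by
      have := hdist (.cons hxy .nil)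
      simp at this
    have hne : x ≠ y := by
      rintro rfl
      have := hdist .nil
      simp at this
    have hpair : (x = a ∧ y = c) ∨ (x = c ∧ y = a) := by
      simp only [Set.mem_insert_iff, Set.mem_singleton_iff] at hx hy
      rcases hx with rfl | rfl | rfl <;> rcases hy with rfl | rfl | rfl <;>
        simp_all [G.adj_comm]
    have hq : q.length = 0 := by
      rcases hpair with ⟨rfl, rfl⟩ | ⟨rfl, rfl⟩
      · have := hdist (.cons hau (.cons huc .nil))
        simp only [Walk.length_cons, Walk.length_nil] at this
        omega
      · have := hdist (.cons huc.symm (.cons hau.symm .nil))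
        simp only [Walk.length_cons, Walk.length_nil] at this
        omega
    obtain rfl := Walk.eq_of_length_eq_zero hq
    have hv : v = u := by
      rcases hpair with ⟨rfl, rfl⟩ | ⟨rfl, rfl⟩
      · exact hw v h h'
      · exact hw v h'.symm h.symm
    rw [Walk.eq_nil_iff_nil.mpr (Walk.length_eq_zero_iff.mp hq)] at hz
    simp only [Walk.support_cons, Walk.support_nil, List.mem_cons, List.not_mem_nil,
      or_false] at hz
    rcases hz with rfl | rfl | rfl
    · exact hx
    · simp [hv]
    · exact hy

/-- A bypass vertex lying between two nonadjacent neighbours can be replaced by another common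
neighbour. -/
theorem BypassVertex.exists_ne_common_neighbor {V : Type*} {G : SimpleGraph V} {a u c : V}
    (hu : BypassVertex G u) (hac : a ≠ c) (hau : G.Adj a u) (huc : G.Adj u c)
    (hnadj : ¬ G.Adj a c) : ∃ w, w ≠ u ∧ G.Adj a w ∧ G.Adj w c := by
  by_contra! h
  refine hu ⟨a, c, hac, hau, huc, hnadj, convexSet_of_unique_common_neighbor hau huc ?_⟩
  intro w haw hwc
  by_contra hne
  exact h w hne haw hwc

/-- In a connected graph, a vertex `x` distinct from `y` has a neighbour one step closer to `y`. -/
theorem SimpleGraph.Connected.exists_adj_dist_add_one {V : Type*} {G : SimpleGraph V}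
    (hG : G.Connected) {x y : V} (hne : x ≠ y) : ∃ v, G.Adj x v ∧ G.dist v y + 1 = G.dist x y := by
  obtain ⟨p, hp⟩ := hG.exists_walk_length_eq_dist x y
  cases p with
  | nil => exact absurd rfl hne
  | cons h q =>
    refine ⟨_, h, le_antisymm ?_ ?_⟩
    · have := dist_le q
      rw [← hp, Walk.length_cons]
      omega
    · obtain ⟨r, hr⟩ := hG.exists_walk_length_eq_dist _ y
      have := dist_le (Walk.cons h r)
      rw [Walk.length_cons] at this
      omega

/-- A vertex of a walk is at distance at most the length of the walk from its start. -/
theorem SimpleGraph.Walk.dist_le_length_of_mem_support {V : Type*} {G : SimpleGraph V} {x y z : V}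
    (p : G.Walk x y) (hz : z ∈ p.support) : G.dist x z ≤ p.length := by
  classical
  exact (dist_le (p.takeUntil z hz)).trans (p.length_takeUntil_le_length hz)

/-- In a connected graph, a bypass vertex forms a total mutual-visibility set on its own. -/
theorem BypassVertex.totalMutualVisSet_singleton {V : Type*} {G : SimpleGraph V}
    (hG : G.Connected) {u : V} (hu : BypassVertex G u) : TotalMutualVisSet G {u} := by
  classical
  intro x y
  obtain ⟨p, hp⟩ := hG.exists_walk_length_eq_dist x y
  by_cases hxy : u = x ∨ u = y
  · exact ⟨p, p.isPath_of_length_eq_dist hp, hp, by rintro z - rfl; exact hxy⟩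
  by_cases hmem : u ∈ p.support
  swap
  · exact ⟨p, p.isPath_of_length_eq_dist hp, hp, by rintro z hz rfl; exact absurd hz hmem⟩
  push Not at hxy
  have hsum : G.dist x u + G.dist u y ≤ G.dist x y := by
    have h := congrArg Walk.length (p.take_spec hmem)
    rw [Walk.length_append] at h
    have h₁ := dist_le (p.takeUntil u hmem)
    have h₂ := dist_le (p.dropUntil u hmem)
    omega
  obtain ⟨a, hua, ha⟩ := hG.exists_adj_dist_add_one hxy.1
  obtain ⟨c, huc, hc⟩ := hG.exists_adj_dist_add_one hxy.2
  rw [dist_comm, G.dist_comm (u := u)] at ha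
  obtain ⟨q, hq⟩ := hG.exists_walk_length_eq_dist x a
  obtain ⟨r, hr⟩ := hG.exists_walk_length_eq_dist c y
  have hac : a ≠ c := by
    rintro rfl
    have := dist_le (q.append r)
    rw [Walk.length_append] at this
    omega
  have hnadj : ¬ G.Adj a c := fun h => by
    have := dist_le (q.append (.cons h r))
    rw [Walk.length_append, Walk.length_cons] at this
    omega
  obtain ⟨w, hwu, haw, hwc⟩ := hu.exists_ne_common_neighbor hac hua.symm huc hnadj
  have hlen : (q.append (.cons haw (.cons hwc r))).length = G.dist x y := by
    refine le_antisymm ?_ (dist_le _)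
    simp only [Walk.length_append, Walk.length_cons]
    omega
  refine ⟨_, Walk.isPath_of_length_eq_dist _ hlen, hlen, ?_⟩
  rintro z hz rfl
  exfalso
  rw [Walk.mem_support_append_iff, Walk.support_cons, Walk.support_cons, List.mem_cons,
    List.mem_cons] at hz
  rcases hz with hz | rfl | rfl | hz
  · have := q.dist_le_length_of_mem_support hz
    omega
  · exact G.loopless.irrefl _ hua
  · exact hwu rfl
  · have := r.reverse.dist_le_length_of_mem_support (by simpa using hz)
    rw [Walk.length_reverse, dist_comm] at this
    omega

/-- The middle vertex of a convex `P_3` lies in no total mutual-visibility set. -/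
theorem ConvexP3Mid.notMem_of_totalMutualVisSet {V : Type*} {G : SimpleGraph V} {u : V}
    (hu : ConvexP3Mid G u) {X : Set V} (hX : TotalMutualVisSet G X) : u ∉ X := by
  intro huX
  obtain ⟨a, c, hac, hau, huc, hnadj, hconv⟩ := hu
  obtain ⟨p, hp, hlen, hvis⟩ := hX a c
  have hsub := hconv a (by simp) c (by simp) p hp hlen
  cases p with
  | nil => exact hac rfl
  | @cons _ v _ h q =>
    have hv : v ∈ (Walk.cons h q).support := by simp
    rcases hsub v hv with rfl | rfl | rfl
    · exact G.loopless.irrefl _ h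
    · rcases hvis v hv huX with rfl | rfl
      · exact G.loopless.irrefl _ hau
      · exact G.loopless.irrefl _ huc
    · exact hnadj h

/-- In a finite graph, `μₜ(G) = 0` iff every total mutual-visibility set is empty. -/
theorem totalMutualVisNum_eq_zero_iff {V : Type*} [Finite V] (G : SimpleGraph V) :
    totalMutualVisNum G = 0 ↔ ∀ X : Set V, TotalMutualVisSet G X → X = ∅ := by
  have hbdd : BddAbove {n | ∃ X : Set V, TotalMutualVisSet G X ∧ X.ncard = n} := by
    refine ⟨Nat.card V, ?_⟩
    rintro n ⟨X, -, rfl⟩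
    exact Set.ncard_le_card X
  constructor
  · intro h X hX
    have hle : X.ncard ≤ totalMutualVisNum G := le_csSup hbdd ⟨X, hX, rfl⟩
    rw [h, Nat.le_zero] at hle
    exact (Set.ncard_eq_zero).mp hle
  · intro h
    refine Nat.le_zero.mp (csSup_le' ?_)
    rintro n ⟨X, hX, rfl⟩
    simp [h X hX]

/-- For a connected graph `G` with at least two vertices, `μₜ(G) = 0` iff `G`
has no bypass vertex. -/
theorem totalMu_eq_zero_iff {V : Type*} [Fintype V] (G : SimpleGraph V)
    (hG : G.Connected) (hn : 2 ≤ Fintype.card V) :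
    totalMutualVisNum G = 0 ↔ ∀ u : V, ¬ BypassVertex G u := by
  rw [totalMutualVisNum_eq_zero_iff]
  constructor
  · intro h u hu
    exact Set.singleton_ne_empty u (h _ (hu.totalMutualVisSet_singleton hG))
  · intro h X hX
    refine Set.eq_empty_of_forall_notMem fun u => ?_
    exact (not_not.mp (h u)).notMem_of_totalMutualVisSet hX
end

section
/- The mutual-visibility number of the d-dimensional butterfly satisfies μ(BF(d)) ≤ 2^{d+1} - 2, for all d ≥ 2. -/
open SimpleGraph

/-- The butterfly graph `BF(d)`: vertices `[ℓ, c]` with level `ℓ : Fin (d+1)`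
and column `c : Fin d → Bool`; `[ℓ,c]` and `[ℓ+1,c']` are adjacent iff `c` and
`c'` agree on every bit other than bit `ℓ` (so `c = c'` or they differ exactly
in bit `ℓ`). -/
def BF (d : ℕ) : SimpleGraph (Fin (d + 1) × (Fin d → Bool)) :=
  SimpleGraph.fromRel (fun u v =>
    (u.1 : ℕ) + 1 = (v.1 : ℕ) ∧ ∀ i : Fin d, (i : ℕ) ≠ (u.1 : ℕ) → u.2 i = v.2 i)

namespace BF

variable {d : ℕ}

theorem adj_iff {u v : Fin (d + 1) × (Fin d → Bool)} : (BF d).Adj u v ↔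
    ((u.1 : ℕ) + 1 = v.1 ∧ ∀ i : Fin d, (i : ℕ) ≠ u.1 → u.2 i = v.2 i) ∨
    ((v.1 : ℕ) + 1 = u.1 ∧ ∀ i : Fin d, (i : ℕ) ≠ v.1 → v.2 i = u.2 i) := by
  rw [BF, SimpleGraph.fromRel_adj]
  refine ⟨fun h => h.2, fun h => ⟨?_, h⟩⟩
  rintro rfl
  rcases h with h | h <;> omega

/-- The column reached at level `j` by the descending path from `[0, s]` to `[d, t]`. -/
def mix (j : ℕ) (s t : Fin d → Bool) : Fin d → Bool := fun i => if (i : ℕ) < j then t i else s i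

theorem mix_self (j : ℕ) (s : Fin d → Bool) : mix j s s = s := by
  funext i; simp [mix]

theorem exists_descending_walk (s t : Fin d → Bool) (k : ℕ) :
    ∀ a b : Fin (d + 1), (a : ℕ) + k = b →
      ∃ p : (BF d).Walk (a, mix a s t) (b, mix b s t), p.length = k := by
  induction k with
  | zero =>
    intro a b h
    obtain rfl : a = b := Fin.ext (by omega)
    exact ⟨.nil, rfl⟩
  | succ k ih =>
    intro a b h
    obtain ⟨p, hp⟩ := ih ⟨a + 1, by omega⟩ b (by simp; omega)
    refine ⟨.cons (adj_iff.2 (Or.inl ⟨rfl, fun i hi => ?_⟩)) p, by simp [hp]⟩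
    simp only [mix] at *
    have : (i : ℕ) < a ↔ (i : ℕ) < a + 1 := by omega
    simp [this]

theorem exists_column_walk (c : Fin d → Bool) {a b : Fin (d + 1)} (h : a ≤ b) :
    ∃ p : (BF d).Walk (a, c) (b, c), p.length = b - a := by
  obtain ⟨p, hp⟩ := exists_descending_walk c c (b - a) a b (by have : (a : ℕ) ≤ b := h; omega)
  exact ⟨p.copy (by rw [mix_self]) (by rw [mix_self]), by rw [SimpleGraph.Walk.length_copy, hp]⟩

theorem level_le_add_length {u v : Fin (d + 1) × (Fin d → Bool)} (p : (BF d).Walk u v) :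
    (v.1 : ℕ) ≤ u.1 + p.length := by
  induction p with
  | nil => simp
  | cons h p ih =>
    rw [SimpleGraph.Walk.length_cons]
    rcases adj_iff.1 h with h | h <;> omega

/-- A walk that descends at every step is determined by its ends. -/
theorem descending_walk {u v : Fin (d + 1) × (Fin d → Bool)} (p : (BF d).Walk u v)
    (hp : (v.1 : ℕ) = u.1 + p.length) :
    (∀ i : Fin d, (i : ℕ) < u.1 → u.2 i = v.2 i) ∧
    ∀ j : Fin (d + 1), u.1 ≤ j → j ≤ v.1 → (j, mix j u.2 v.2) ∈ p.support := by
  induction p with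
  | nil =>
    refine ⟨fun _ _ => rfl, fun j h₁ h₂ => ?_⟩
    simp [mix_self, le_antisymm h₂ h₁]
  | @cons u u' v h p ih =>
    rw [SimpleGraph.Walk.length_cons] at hp
    have hle := level_le_add_length p
    rcases adj_iff.1 h with ⟨h₁, h₂⟩ | h
    swap
    · omega
    obtain ⟨ih₁, ih₂⟩ := ih (by omega)
    have low : ∀ i : Fin d, (i : ℕ) < u.1 → u.2 i = v.2 i := fun i hi => by
      rw [h₂ i (by omega), ih₁ i (by omega)]
    refine ⟨low, fun j hj₁ hj₂ => ?_⟩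
    rw [SimpleGraph.Walk.support_cons, List.mem_cons]
    rcases eq_or_lt_of_le hj₁ with rfl | hlt
    · left
      refine Prod.ext rfl (funext fun i => ?_)
      by_cases hi : (i : ℕ) < u.1
      · simp [mix, hi, low i hi]
      · simp [mix, hi]
    · right
      have hlt' : (u.1 : ℕ) < j := hlt
      convert ih₂ j (by rw [Fin.le_def]; omega) hj₂ using 2
      funext i
      by_cases hi : (i : ℕ) < j
      · simp [mix, hi]
      · simp [mix, hi, h₂ i (by omega)]

theorem exists_mem_support_level {u v : Fin (d + 1) × (Fin d → Bool)} (p : (BF d).Walk u v)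
    (m : Fin d) (hm : u.2 m ≠ v.2 m) : ∃ z ∈ p.support, (z.1 : ℕ) = m + 1 := by
  induction p with
  | nil => exact absurd rfl hm
  | @cons u u' v h p ih =>
    by_cases hm' : u'.2 m = v.2 m
    · have hne : u.2 m ≠ u'.2 m := by rwa [hm']
      rcases adj_iff.1 h with ⟨h₁, h₂⟩ | ⟨h₁, h₂⟩
      · have : (m : ℕ) = u.1 := by by_contra hc; exact hne (h₂ m hc)
        exact ⟨u', by simp, by omega⟩
      · have : (m : ℕ) = u'.1 := by by_contra hc; exact hne (h₂ m hc).symm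
        exact ⟨u, by simp, by omega⟩
    · obtain ⟨z, hz, hz'⟩ := ih hm'
      exact ⟨z, by simp [hz], hz'⟩

open Classical in
/-- The number of vertices of `X` on the descending path from `[0, s]` to `[d, t]`. -/
noncomputable def pathCount (X : Set (Fin (d + 1) × (Fin d → Bool))) (s t : Fin d → Bool) : ℕ :=
  (Finset.univ.filter fun l : Fin (d + 1) => (l, mix l s t) ∈ X).card

theorem pathCount_le_two {X : Set (Fin (d + 1) × (Fin d → Bool))} (hX : MutualVisSet (BF d) X)
    (s t : Fin d → Bool) : pathCount X s t ≤ 2 := by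
  classical
  by_contra! h
  obtain ⟨a, b, c, ha, hb, hc, hab, hbc⟩ : ∃ a b c : Fin (d + 1), (a, mix a s t) ∈ X ∧
      (b, mix b s t) ∈ X ∧ (c, mix c s t) ∈ X ∧ a < b ∧ b < c := by
    unfold pathCount at h
    set S := Finset.univ.filter fun l : Fin (d + 1) => (l, mix l s t) ∈ X with hS
    have hf : ∀ k, (S.orderEmbOfFin rfl k, mix (S.orderEmbOfFin rfl k) s t) ∈ X := fun k =>
      (Finset.mem_filter.1 (S.orderEmbOfFin_mem rfl k)).2
    exact ⟨_, _, _, hf ⟨0, by omega⟩, hf ⟨1, by omega⟩, hf ⟨2, h⟩,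
      (S.orderEmbOfFin rfl).strictMono (by rw [Fin.lt_def]; simp),
      (S.orderEmbOfFin rfl).strictMono (by rw [Fin.lt_def]; simp)⟩
  obtain ⟨p, -, hp, hvis⟩ := hX _ ha _ hc
  have hab' : (a : ℕ) < b := hab
  have hbc' : (b : ℕ) < c := hbc
  obtain ⟨q, hq⟩ := exists_descending_walk s t (c - a) a c (by omega)
  have h₁ := SimpleGraph.dist_le q
  have h₂ := level_le_add_length p
  simp only at h₂
  have hmem := (descending_walk p (by simp only; omega)).2 b hab.le hbc.le
  have hmix : mix b (mix a s t) (mix c s t) = mix b s t := by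
    funext i
    simp only [mix]
    split_ifs <;> first | rfl | omega
  simp only [hmix] at hmem
  rcases hvis _ hmem hb with h | h
  · exact hab.ne' (congrArg Prod.fst h)
  · exact hbc.ne (congrArg Prod.fst h)

open Classical in
theorem sum_pathCount (X : Set (Fin (d + 1) × (Fin d → Bool))) (τ : (Fin d → Bool) → Fin d → Bool)
    (hτ : ∀ j ≤ d, Function.Injective fun c => mix j c (τ c)) :
    ∑ c, pathCount X c (τ c) = X.ncard := by
  have hcard : X.ncard = ∑ v : Fin (d + 1) × (Fin d → Bool), if v ∈ X then 1 else 0 := by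
    rw [Set.ncard_eq_toFinset_card', Finset.sum_boole]
    simp [Set.toFinset]
  rw [hcard, Fintype.sum_prod_type]
  simp only [pathCount, Finset.card_filter]
  rw [Finset.sum_comm]
  refine Finset.sum_congr rfl fun l _ => ?_
  exact (Finite.injective_iff_bijective.1 (hτ l (by omega))).sum_comp
    (fun c => if (l, c) ∈ X then 1 else 0)

theorem ncard_le_of_pathCount_le_one {X : Set (Fin (d + 1) × (Fin d → Bool))}
    (hX : MutualVisSet (BF d) X) (τ : (Fin d → Bool) → Fin d → Bool)
    (hτ : ∀ j ≤ d, Function.Injective fun c => mix j c (τ c)) {a b : Fin d → Bool} (hab : a ≠ b)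
    (ha : pathCount X a (τ a) ≤ 1) (hb : pathCount X b (τ b) ≤ 1) :
    X.ncard ≤ 2 ^ (d + 1) - 2 := by
  have key : ∑ c, (pathCount X c (τ c) + if c ∈ ({a, b} : Finset (Fin d → Bool)) then 1 else 0)
      ≤ ∑ _c : Fin d → Bool, 2 := by
    refine Finset.sum_le_sum fun c _ => ?_
    have := pathCount_le_two hX c (τ c)
    split_ifs with h
    · rcases Finset.mem_insert.1 h with rfl | h
      · omega
      · obtain rfl := Finset.mem_singleton.1 h
        omega
    · omega
  rw [Finset.sum_add_distrib, sum_pathCount X τ hτ, Finset.sum_boole,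
    Finset.filter_mem_eq_inter, Finset.univ_inter, Finset.card_pair hab] at key
  simp at key
  rw [pow_succ]
  omega

theorem exists_top_of_two_le {X : Set (Fin (d + 1) × (Fin d → Bool))} {c : Fin d → Bool}
    (h : 2 ≤ pathCount X c c) :
    ∃ l : Fin (d + 1), (l : ℕ) < d ∧ (l, c) ∈ X ∧ ∀ j < l, (j, c) ∉ X := by
  classical
  simp only [pathCount, mix_self] at h
  obtain ⟨a, ha, b, hb, hab⟩ := Finset.one_lt_card.1 h
  set S := Finset.univ.filter fun l : Fin (d + 1) => (l, c) ∈ X with hS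
  have hne : S.Nonempty := ⟨a, ha⟩
  refine ⟨S.min' hne, ?_, (Finset.mem_filter.1 (S.min'_mem hne)).2, fun j hj hjX => ?_⟩
  · have h₁ : (S.min' hne : ℕ) ≤ a := S.min'_le a ha
    have h₂ : (S.min' hne : ℕ) ≤ b := S.min'_le b hb
    have h₃ : (a : ℕ) ≠ b := fun h => hab (Fin.ext h)
    omega
  · exact absurd (S.min'_le j (by simp [hS, hjX])) (not_le.2 hj)

/-- If no vertex of column `c` above level `l` is in `X`, and neither is any vertex below level `l`
of the path from `[0, c]` to `[d, w]` through `[l, c]`, then that path meets `X` at most once. -/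
theorem pathCount_le_one_of_descent {X : Set (Fin (d + 1) × (Fin d → Bool))}
    {c w : Fin d → Bool} {l : Fin (d + 1)} (htop : ∀ j < l, (j, c) ∉ X)
    (hlow : ∀ i : Fin d, (i : ℕ) < l → c i = w i)
    (hclear : ∀ j, l < j → (j, mix j c w) ∉ X) : pathCount X c w ≤ 1 := by
  classical
  rw [pathCount, Finset.card_le_one_iff_subset_singleton]
  refine ⟨l, fun j hj => ?_⟩
  rw [Finset.mem_filter] at hj
  rw [Finset.mem_singleton]
  rcases lt_trichotomy j l with h | h | h
  · refine absurd hj.2 ?_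
    have hm : mix j c w = c := by
      funext i
      have hjl : (j : ℕ) < l := h
      by_cases hi : (i : ℕ) < j
      · simp [mix, hi, hlow i (by omega)]
      · simp [mix, hi]
    rw [hm]
    exact htop j h
  · exact h
  · exact absurd hj.2 (hclear j h)

theorem exists_turn {X : Set (Fin (d + 1) × (Fin d → Bool))} (hX : MutualVisSet (BF d) X)
    (m : Fin d) (hmd : (m : ℕ) + 1 = d) {c c' : Fin d → Bool} (hm : c m ≠ c' m)
    (hcc' : ∀ i ≠ m, c i = c' i) (hc : 2 ≤ pathCount X c c) (hc' : 2 ≤ pathCount X c' c') :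
    ∃ w, pathCount X c w ≤ 1 ∧ pathCount X c' w ≤ 1 := by
  obtain ⟨l, hl, hlX, htop⟩ := exists_top_of_two_le hc
  obtain ⟨l', hl', hlX', htop'⟩ := exists_top_of_two_le hc'
  obtain ⟨p, -, hp, hvis⟩ := hX _ hlX _ hlX'
  obtain ⟨q₁, hq₁⟩ := exists_column_walk c (a := l) (b := Fin.last d) (Fin.le_last l)
  obtain ⟨q₂, hq₂⟩ := exists_column_walk c' (a := l') (b := m.castSucc)
    (by rw [Fin.le_def]; simp; omega)
  have hadj : (BF d).Adj (Fin.last d, c) (m.castSucc, c') := adj_iff.2 <| Or.inr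
    ⟨by simp [hmd], fun i hi => (hcc' i fun h => hi (by simp [h])).symm⟩
  have hdist := SimpleGraph.dist_le (q₁.append (.cons hadj q₂.reverse))
  simp only [SimpleGraph.Walk.length_append, SimpleGraph.Walk.length_cons,
    SimpleGraph.Walk.length_reverse, Fin.val_last, Fin.val_castSucc] at hdist hq₁ hq₂
  obtain ⟨⟨e, w⟩, hz, hlev⟩ := exists_mem_support_level p m hm
  simp only at hlev
  have hsplit := congrArg SimpleGraph.Walk.length (p.take_spec hz)
  rw [SimpleGraph.Walk.length_append] at hsplit
  have h₁ := level_le_add_length (p.takeUntil _ hz)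
  have h₂ := level_le_add_length (p.dropUntil _ hz).reverse
  simp only [SimpleGraph.Walk.length_reverse] at h₁ h₂
  obtain ⟨low₁, mem₁⟩ := descending_walk (p.takeUntil _ hz) (by simp only; omega)
  obtain ⟨low₂, mem₂⟩ := descending_walk (p.dropUntil _ hz).reverse
    (by simp only [SimpleGraph.Walk.length_reverse]; omega)
  refine ⟨w, pathCount_le_one_of_descent htop low₁ fun j hj hjX => ?_,
    pathCount_le_one_of_descent htop' low₂ fun j hj hjX => ?_⟩
  · have hmem := p.support_takeUntil_subset_support hz (mem₁ j hj.le (by rw [Fin.le_def]; simp only; omega))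
    rcases hvis _ hmem hjX with h | h
    · exact hj.ne' (congrArg Prod.fst h)
    · have h₁ : j = l' := congrArg Prod.fst h
      have h₂ : mix j c w m = c' m := congrFun (congrArg Prod.snd h) m
      have : ¬ (m : ℕ) < j := by rw [h₁]; omega
      simp only [mix, this, if_false] at h₂
      exact hm h₂
  · have hmem := mem₂ j hj.le (by rw [Fin.le_def]; simp only; omega)
    rw [SimpleGraph.Walk.support_reverse, List.mem_reverse] at hmem
    rcases hvis _ (p.support_dropUntil_subset_support hz hmem) hjX with h | h
    · have h₁ : j = l := congrArg Prod.fst h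
      have h₂ : mix j c' w m = c m := congrFun (congrArg Prod.snd h) m
      have : ¬ (m : ℕ) < j := by rw [h₁]; omega
      simp only [mix, this, if_false] at h₂
      exact hm h₂.symm
    · exact hj.ne' (congrArg Prod.fst h)

theorem ncard_le_or_exists_turn {X : Set (Fin (d + 1) × (Fin d → Bool))}
    (hX : MutualVisSet (BF d) X) (m o : Fin d) (hmd : (m : ℕ) + 1 = d) (hom : o ≠ m) :
    X.ncard ≤ 2 ^ (d + 1) - 2 ∨
      ∃ c c' w, c m ≠ c' m ∧ pathCount X c w ≤ 1 ∧ pathCount X c' w ≤ 1 := by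
  by_cases h : ∃ c : Fin d → Bool, 2 ≤ pathCount X c c ∧
      2 ≤ pathCount X (Function.update c m (!c m)) (Function.update c m (!c m))
  · right
    obtain ⟨c, hc, hc'⟩ := h
    have hm : c m ≠ Function.update c m (!c m) m := by simp
    obtain ⟨w, hw⟩ := exists_turn hX m hmd hm (fun i hi => by simp [hi]) hc hc'
    exact ⟨c, _, w, hm, hw⟩
  · left
    push Not at h
    have deficient : ∀ b : Bool, ∃ c : Fin d → Bool, c o = b ∧ pathCount X c c ≤ 1 := fun b => by
      by_cases hb : 2 ≤ pathCount X (fun _ => b) (fun _ => b)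
      · exact ⟨_, by simp [hom], Nat.le_of_lt_succ (h _ hb)⟩
      · exact ⟨fun _ => b, rfl, by omega⟩
    obtain ⟨a, ha, ha'⟩ := deficient false
    obtain ⟨b, hb, hb'⟩ := deficient true
    refine ncard_le_of_pathCount_le_one hX id (fun j _ => ?_) (a := a) (b := b) ?_ ha' hb'
    · simp only [id, mix_self]
      exact fun _ _ h => h
    · rintro rfl
      simp [ha] at hb

/-- The reflection of the butterfly exchanging levels `ℓ` and `d - ℓ`. -/
def reflect (u : Fin (d + 1) × (Fin d → Bool)) : Fin (d + 1) × (Fin d → Bool) :=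
  (u.1.rev, u.2 ∘ Fin.rev)

theorem reflect_reflect (u : Fin (d + 1) × (Fin d → Bool)) : reflect (reflect u) = u := by
  refine Prod.ext (Fin.rev_rev _) (funext fun i => ?_)
  simp [reflect]

def reflectHom (d : ℕ) : BF d →g BF d where
  toFun := reflect
  map_rel' := by
    intro u v h
    rw [adj_iff] at h ⊢
    simp only [reflect, Fin.val_rev, Function.comp]
    rcases h with ⟨h₁, h₂⟩ | ⟨h₁, h₂⟩
    · exact Or.inr ⟨by omega, fun i hi => (h₂ _ (by rw [Fin.val_rev]; omega)).symm⟩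
    · exact Or.inl ⟨by omega, fun i hi => (h₂ _ (by rw [Fin.val_rev]; omega)).symm⟩

theorem mutualVisSet_preimage_reflect {X : Set (Fin (d + 1) × (Fin d → Bool))}
    (hX : MutualVisSet (BF d) X) : MutualVisSet (BF d) (reflect ⁻¹' X) := by
  intro x hx y hy
  obtain ⟨p, -, hp, hvis⟩ := hX _ hx _ hy
  have hr : ∀ u, reflectHom d (reflect u) = u := reflect_reflect
  let q : (BF d).Walk x y := (p.map (reflectHom d)).copy (hr x) (hr y)
  have hq : q.length = (BF d).dist x y := by
    refine le_antisymm ?_ (SimpleGraph.dist_le q)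
    obtain ⟨r, hr'⟩ := (SimpleGraph.Walk.reachable q).exists_walk_length_eq_dist
    have hle : (BF d).dist (reflect x) (reflect y) ≤ (r.map (reflectHom d)).length :=
      SimpleGraph.dist_le _
    rw [SimpleGraph.Walk.length_map, hr'] at hle
    simpa [q, hp] using hle
  refine ⟨q, SimpleGraph.Walk.isPath_of_length_eq_dist q hq, hq, fun z hz hzX => ?_⟩
  simp only [q, SimpleGraph.Walk.support_copy, SimpleGraph.Walk.support_map, List.mem_map] at hz
  obtain ⟨z', hz', rfl⟩ := hz
  have hzX' : z' ∈ X := by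
    have : reflect (reflect z') ∈ X := hzX
    rwa [reflect_reflect] at this
  rcases hvis z' hz' hzX' with rfl | rfl
  · exact Or.inl (hr x)
  · exact Or.inr (hr y)

theorem pathCount_preimage_reflect (X : Set (Fin (d + 1) × (Fin d → Bool)))
    (s t : Fin d → Bool) :
    pathCount (reflect ⁻¹' X) s t = pathCount X (t ∘ Fin.rev) (s ∘ Fin.rev) := by
  classical
  refine Finset.card_equiv Fin.revPerm fun l => ?_
  have : reflect (l, mix l s t) = (l.rev, mix l.rev (t ∘ Fin.rev) (s ∘ Fin.rev)) := by
    refine Prod.ext rfl (funext fun i => ?_)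
    simp only [reflect, mix, Function.comp, Fin.val_rev]
    split_ifs <;> first | rfl | omega
  simp [this]

theorem ncard_le_of_disjoint_deficient {X : Set (Fin (d + 1) × (Fin d → Bool))}
    (hX : MutualVisSet (BF d) X) (m o : Fin d) (hmd : (m : ℕ) + 1 = d) (ho : (o : ℕ) = 0)
    (hom : o ≠ m) {s w z t : Fin d → Bool} (hsz : s m ≠ z m) (hwt : w o ≠ t o)
    (h₁ : pathCount X s w ≤ 1) (h₂ : pathCount X z t ≤ 1) :
    X.ncard ≤ 2 ^ (d + 1) - 2 := by
  let σ : (Fin d → Bool) → Fin d → Bool := fun c i =>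
    xor (c i) (if c m = s m then xor (s i) (w i) else xor (z i) (t i))
  let τ : (Fin d → Bool) → Fin d → Bool := fun c i =>
    if i = m then xor (c m) (if σ c o = w o then xor (s m) (w m) else xor (z m) (t m)) else σ c i
  have hσ : ∀ {c c' : Fin d → Bool} {i : Fin d}, c m = c' m → σ c i = σ c' i → c i = c' i := by
    intro c c' i hm h
    simpa [σ, hm] using h
  have hs : τ s = w := by
    funext i
    by_cases hi : i = m
    · subst hi; simp [τ, σ]
    · simp [τ, σ, hi]
  have hz : τ z = t := by
    funext i
    by_cases hi : i = m
    · subst hi; simp [τ, σ, hsz.symm, hwt.symm]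
    · simp [τ, σ, hi, hsz.symm]
  refine ncard_le_of_pathCount_le_one hX τ (fun j hj c c' hcc' => ?_) (a := s) (b := z)
    (fun h => hsz (by rw [h])) (hs ▸ h₁) (hz ▸ h₂)
  have hbit : ∀ i, mix j c (τ c) i = mix j c' (τ c') i := congrFun hcc'
  have hm : c m = c' m := by
    by_cases hjd : (m : ℕ) < j
    · have h₀ : σ c o = σ c' o := by simpa [mix, τ, show (o : ℕ) < j by omega, hom] using hbit o
      simpa [mix, τ, hjd, h₀] using hbit m
    · simpa [mix, hjd] using hbit m
  funext i
  by_cases hi : i = m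
  · rw [hi, hm]
  by_cases hij : (i : ℕ) < j
  · exact hσ hm (by simpa [mix, τ, hij, hi] using hbit i)
  · simpa [mix, hij] using hbit i

theorem ncard_le_of_mutualVisSet (hd : 2 ≤ d) {X : Set (Fin (d + 1) × (Fin d → Bool))}
    (hX : MutualVisSet (BF d) X) : X.ncard ≤ 2 ^ (d + 1) - 2 := by
  let m : Fin d := ⟨d - 1, by omega⟩
  let o : Fin d := ⟨0, by omega⟩
  have hmd : (m : ℕ) + 1 = d := by simp only [m]; omega
  have hom : o ≠ m := fun h => by have := congrArg Fin.val h; simp only [m, o] at this; omega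
  have hrev : Fin.rev o = m := Fin.ext (by simp [m, o])
  obtain h | ⟨c, c', w, hc, hcw, hcw'⟩ := ncard_le_or_exists_turn hX m o hmd hom
  · exact h
  obtain h | ⟨b, b', z, hb, hbz, hbz'⟩ :=
    ncard_le_or_exists_turn (mutualVisSet_preimage_reflect hX) m o hmd hom
  · rwa [Set.ncard_preimage_of_injective_subset_range
      (Function.LeftInverse.injective reflect_reflect)
      (fun u _ => ⟨reflect u, reflect_reflect u⟩)] at h
  rw [pathCount_preimage_reflect] at hbz hbz'
  obtain ⟨s, hs, hs'⟩ : ∃ s, s m ≠ (z ∘ Fin.rev) m ∧ pathCount X s w ≤ 1 := by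
    by_cases h : c m = (z ∘ Fin.rev) m
    · exact ⟨c', fun h' => hc (h.trans h'.symm), hcw'⟩
    · exact ⟨c, h, hcw⟩
  obtain ⟨t, ht, ht'⟩ : ∃ t, w o ≠ t o ∧ pathCount X (z ∘ Fin.rev) t ≤ 1 := by
    by_cases h : w o = (b ∘ Fin.rev) o
    · exact ⟨_, fun h' => hb (by simpa [hrev] using h.symm.trans h'), hbz'⟩
    · exact ⟨_, h, hbz⟩
  exact ncard_le_of_disjoint_deficient hX m o hmd rfl hom hs ht hs' ht'

end BF

/-- `μ(BF(d)) ≤ 2^{d+1} - 2` for all `d ≥ 2`. -/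
theorem mu_BF_le (d : ℕ) (hd : 2 ≤ d) :
    mutualVisNum (BF d) ≤ 2 ^ (d + 1) - 2 := by
  refine csSup_le' ?_
  rintro n ⟨X, hX, rfl⟩
  exact BF.ncard_le_of_mutualVisSet hd hX
end
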